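/- arXiv:math/0609536 — 6 statements merged into one kernel-verified Lean document; each statement's English description precedes it below -/
import Mathlib

section
/- Let α be an irrational real number and n a positive integer. Let 0 < t₁ < t₂ < ⋯ < tₙ < 1 be the fractional parts {α}, {2α}, …, {nα} arranged in increasing order, and define the gaps g(0) = t₁, g(k) = t_{k+1} − t_k for 1 ≤ k ≤ n−1, and g(n) = 1 − tₙ. Then the set {g(k) : 0 ≤ k ≤ n} has at most 3 elements. -/
/-- A nonzero integer multiple of an irrational number is not an integer. -/
theorem Irrational.intCast_mul_sub_intCast_ne_zero {α : ℝ} (hα : Irrational α) {d : ℤ}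
    (hd : d ≠ 0) (j : ℤ) : (d : ℝ) * α - j ≠ 0 := by
  intro h
  exact (hα.intCast_mul hd).ne_int j (by linarith)

/-- Among the positive values `dα - j` with `1 ≤ d ≤ n` there is a smallest one, and it is
less than `1`. -/
theorem exists_least_pos_int_mul_sub {α : ℝ} (hα : Irrational α) {n : ℤ} (hn : 1 ≤ n) :
    ∃ a A : ℤ, 1 ≤ a ∧ a ≤ n ∧ 0 < (a : ℝ) * α - A ∧ (a : ℝ) * α - A < 1 ∧
      ∀ d j : ℤ, 1 ≤ d → d ≤ n → 0 < (d : ℝ) * α - j → (a : ℝ) * α - A ≤ d * α - j := by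
  obtain ⟨a, ha, hmin⟩ := (Finset.Icc 1 n).exists_min_image
    (fun d : ℤ => Int.fract ((d : ℝ) * α)) ⟨1, by simpa using hn⟩
  rw [Finset.mem_Icc] at ha
  have hne := hα.intCast_mul_sub_intCast_ne_zero (d := a) (by lia) ⌊(a : ℝ) * α⌋
  refine ⟨a, ⌊(a : ℝ) * α⌋, ha.1, ha.2,
    lt_of_le_of_ne (Int.fract_nonneg _) hne.symm, Int.fract_lt_one _, fun d j h1 h2 hpos => ?_⟩
  have hj : (j : ℝ) ≤ ⌊(d : ℝ) * α⌋ := by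
    exact_mod_cast Int.le_floor.2 (by linarith)
  have := hmin d (Finset.mem_Icc.2 ⟨h1, h2⟩)
  simp only [Int.fract] at this
  linarith

/-- There are two lengths `x` and `y` such that the distance from any point `pα` of the orbit
`0, α, …, nα` on the circle `ℝ / ℤ` to the next point of the orbit is `x`, `y` or `x + y`. -/
theorem exists_two_lengths_of_orbit_gaps {α : ℝ} (hα : Irrational α) {n : ℤ} (hn : 1 ≤ n) :
    ∃ x y : ℝ, ∀ p : ℤ, 0 ≤ p → p ≤ n → ∃ δ : ℝ, (δ = x ∨ δ = y ∨ δ = x + y) ∧ 0 < δ ∧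
      (∃ q j : ℤ, 0 ≤ q ∧ q ≤ n ∧ (q : ℝ) * α - j = p * α + δ) ∧
      ∀ m j : ℤ, 0 ≤ m → m ≤ n → 0 < (m : ℝ) * α - j - p * α → δ ≤ m * α - j - p * α := by
  obtain ⟨a, A, ha1, han, hx0, hx1, hx⟩ := exists_least_pos_int_mul_sub hα hn
  obtain ⟨b, B, hb1, hbn, hy0, hy1, hy⟩ := exists_least_pos_int_mul_sub hα.neg hn
  have hab : n < a + b := by
    by_contra! h
    have hne := hα.intCast_mul_sub_intCast_ne_zero (d := a + b) (by lia) (A - B)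
    rcases lt_or_gt_of_ne hne with hlt | hgt
    · have := hy (a + b) (-(A - B)) (by lia) h (by push_cast at hlt ⊢; linarith)
      push_cast at this
      linarith
    · have := hx (a + b) (A - B) (by lia) h hgt
      push_cast at this
      linarith
  have hxy : ((a : ℝ) * α - A) + ((b : ℝ) * -α - B) ≤ 1 := by
    have := hy a (-(A + 1)) ha1 han (by push_cast; linarith)
    push_cast at this
    linarith
  have int_ge : ∀ j : ℤ, 0 < -(j : ℝ) → 1 ≤ -(j : ℝ) := by
    intro j hj
    exact_mod_cast (show (0 : ℤ) < -j by exact_mod_cast hj)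
  refine ⟨(a : ℝ) * α - A, (b : ℝ) * -α - B, fun p hp0 hpn => ?_⟩
  by_cases hpa : p + a ≤ n
  · refine ⟨_, Or.inl rfl, hx0, ⟨p + a, A, by lia, hpa, by push_cast; ring⟩,
      fun m j hm0 hmn hpos => ?_⟩
    by_contra! hlt
    rcases lt_trichotomy m p with h | rfl | h
    · have := hx (p + a - m) (A - j) (by lia) (by lia) (by push_cast; linarith)
      push_cast at this
      linarith
    · linarith [int_ge j (by linarith)]
    · have := hx (m - p) j (by lia) (by lia) (by push_cast; linarith)
      push_cast at this
      linarith
  by_cases hpb : b ≤ p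
  · refine ⟨_, Or.inr (Or.inl rfl), hy0, ⟨p - b, B, by lia, by lia, by push_cast; ring⟩,
      fun m j hm0 hmn hpos => ?_⟩
    by_contra! hlt
    rcases lt_trichotomy m p with h | rfl | h
    · have := hy (p - m) j (by lia) (by lia) (by push_cast; linarith)
      push_cast at this
      linarith
    · linarith [int_ge j (by linarith)]
    · have := hy (m - p + b) (B - j) (by lia) (by lia) (by push_cast; linarith)
      push_cast at this
      linarith
  refine ⟨_, Or.inr (Or.inr rfl), add_pos hx0 hy0,
    ⟨p + a - b, A + B, by lia, by lia, by push_cast; ring⟩, fun m j hm0 hmn hpos => ?_⟩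
  by_contra! hlt
  rcases lt_trichotomy m p with h | rfl | h
  · have h1 := hy (p - m) j (by lia) (by lia) (by push_cast; linarith)
    have hne := hα.intCast_mul_sub_intCast_ne_zero (d := b - (p - m)) (by lia) (-(B - j))
    push_cast at h1 hne
    have h2 := hx (b - (p - m)) (-(B - j)) (by lia) (by lia)
      (by push_cast; exact lt_of_le_of_ne (by linarith) hne.symm)
    push_cast at h2
    linarith
  · linarith [int_ge j (by linarith)]
  · have h1 := hx (m - p) j (by lia) (by lia) (by push_cast; linarith)
    have hne := hα.intCast_mul_sub_intCast_ne_zero (d := a - (m - p)) (by lia) (A - j)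
    push_cast at h1 hne
    have h2 := hy (a - (m - p)) (-(A - j)) (by lia) (by lia) (by
      push_cast
      have := lt_of_le_of_ne (by linarith) hne
      linarith)
    push_cast at h2
    linarith

/-- The three distance theorem (Steinhaus): if `t 1 < t 2 < ⋯ < t n` is the increasing
arrangement of the fractional parts `{α}, {2α}, …, {nα}` of the first `n` multiples of an
irrational `α`, then the gaps `g 0 = t 1`, `g k = t (k+1) - t k` (for `1 ≤ k ≤ n-1`) and
`g n = 1 - t n` take at most three distinct values. -/
theorem three_distance_theorem
    (α : ℝ) (hα : Irrational α) (n : ℕ) (hn : 1 ≤ n)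
    (t : ℕ → ℝ)
    (ht : StrictMonoOn t (Set.Icc 1 n))
    (himg : (Finset.Icc 1 n).image t
      = (Finset.Icc 1 n).image (fun k : ℕ => Int.fract ((k : ℝ) * α))) :
    ((Finset.Icc 0 n).image (fun k =>
        if k = 0 then t 1
        else if k = n then 1 - t n
        else t (k + 1) - t k)).card ≤ 3 := by
  obtain ⟨x, y, hxy⟩ := exists_two_lengths_of_orbit_gaps hα (n := (n : ℤ)) (by lia)
  have t_eq : ∀ i, 1 ≤ i → i ≤ n → ∃ m j : ℤ, 0 ≤ m ∧ m ≤ n ∧ t i = m * α - j ∧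
      0 < t i ∧ t i < 1 := by
    intro i h1 h2
    have hmem := Finset.mem_image_of_mem t (Finset.mem_Icc.2 ⟨h1, h2⟩)
    rw [himg] at hmem
    obtain ⟨m, hm, hmt⟩ := Finset.mem_image.1 hmem
    rw [Finset.mem_Icc] at hm
    have hne := hα.intCast_mul_sub_intCast_ne_zero (d := (m : ℤ)) (by lia) ⌊(m : ℝ) * α⌋
    rw [← hmt]
    exact ⟨m, ⌊(m : ℝ) * α⌋, by lia, by lia, by simp,
      lt_of_le_of_ne (Int.fract_nonneg _) (by simpa using hne.symm), Int.fract_lt_one _⟩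
  have eq_t : ∀ q j : ℤ, 0 ≤ q → q ≤ n → 0 < (q : ℝ) * α - j → (q : ℝ) * α - j < 1 →
      ∃ i, 1 ≤ i ∧ i ≤ n ∧ t i = q * α - j := by
    intro q j h0 h1 hpos hlt
    lift q to ℕ using h0
    have hq : q ≠ 0 := by
      rintro rfl
      simp only [Nat.cast_zero, Int.cast_zero, zero_mul, zero_sub] at hpos hlt
      have h2 : (0 : ℤ) < -j := by exact_mod_cast hpos
      have h3 : -j < (1 : ℤ) := by exact_mod_cast hlt
      lia
    have hmem := Finset.mem_image_of_mem (fun k : ℕ => Int.fract ((k : ℝ) * α))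
      (Finset.mem_Icc.2 ⟨Nat.one_le_iff_ne_zero.2 hq, (by lia : q ≤ n)⟩)
    rw [← himg] at hmem
    obtain ⟨i, hi, hit⟩ := Finset.mem_image.1 hmem
    rw [Finset.mem_Icc] at hi
    refine ⟨i, hi.1, hi.2, hit.trans (Int.fract_eq_iff.2 ⟨?_, ?_, j, ?_⟩)⟩ <;>
      push_cast at * <;> linarith
  have gap : ∀ u v : ℝ, 0 ≤ u → u < v → v ≤ 1 →
      (∃ p j : ℤ, 0 ≤ p ∧ p ≤ n ∧ u = p * α - j) →
      (∃ p j : ℤ, 0 ≤ p ∧ p ≤ n ∧ v = p * α - j) →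
      (∀ i, 1 ≤ i → i ≤ n → t i ≤ u ∨ v ≤ t i) →
      v - u = x ∨ v - u = y ∨ v - u = x + y := by
    rintro u v hu huv hv ⟨p, j, hp0, hpn, rfl⟩ ⟨m, l, hm0, hmn, rfl⟩ hbetween
    obtain ⟨δ, hδ, hδ0, ⟨q, s, hq0, hqn, hq⟩, hmin⟩ := hxy p hp0 hpn
    have hle := hmin m (l - j) hm0 hmn (by push_cast; linarith)
    push_cast at hle
    have hge : (m : ℝ) * α - l ≤ p * α - j + δ := by
      by_contra! hlt
      obtain ⟨i, hi1, hin, hi⟩ := eq_t q (s + j) hq0 hqn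
        (by push_cast; linarith) (by push_cast; linarith)
      push_cast at hi
      rcases hbetween i hi1 hin with h | h <;> linarith
    rwa [show (m : ℝ) * α - l - (p * α - j) = δ by linarith]
  refine (Finset.card_le_card (t := {x, y, x + y}) ?_).trans Finset.card_le_three
  intro g hg
  obtain ⟨k, hk, rfl⟩ := Finset.mem_image.1 hg
  rw [Finset.mem_Icc] at hk
  simp only [Finset.mem_insert, Finset.mem_singleton]
  have mono : ∀ i i', 1 ≤ i → i ≤ i' → i' ≤ n → t i ≤ t i' := fun i i' h1 h2 h3 =>
    ht.monotoneOn ⟨h1, h2.trans h3⟩ ⟨h1.trans h2, h3⟩ h2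
  split_ifs with h0 h1
  · obtain ⟨m, j, hm0, hmn, hm, hpos, hlt⟩ := t_eq 1 le_rfl hn
    simpa using gap 0 (t 1) le_rfl hpos hlt.le ⟨0, 0, le_rfl, by lia, by simp⟩
      ⟨m, j, hm0, hmn, hm⟩ fun i hi1 hin => Or.inr (mono 1 i le_rfl hi1 hin)
  · obtain ⟨m, j, hm0, hmn, hm, hpos, hlt⟩ := t_eq n hn le_rfl
    exact gap (t n) 1 hpos.le hlt le_rfl ⟨m, j, hm0, hmn, hm⟩
      ⟨0, -1, le_rfl, by lia, by simp⟩ fun i hi1 hin => Or.inl (mono i n hi1 hin le_rfl)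
  · obtain ⟨m, j, hm0, hmn, hm, hpos, -⟩ := t_eq k (by lia) hk.2
    obtain ⟨m', j', hm0', hmn', hm', -, hlt⟩ := t_eq (k + 1) (by lia) (by lia)
    refine gap (t k) (t (k + 1)) hpos.le
      (ht ⟨by lia, hk.2⟩ ⟨by lia, by lia⟩ (Nat.lt_succ_self k)) hlt.le
      ⟨m, j, hm0, hmn, hm⟩ ⟨m', j', hm0', hmn', hm'⟩ fun i hi1 hin => ?_
    rcases le_or_gt i k with h | h
    · exact Or.inl (mono i k hi1 h hk.2)
    · exact Or.inr (mono (k + 1) i (by lia) h hin)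
end

section
/- Let α be an irrational real number and n a positive integer. For 1 ≤ j < k ≤ n define d(j,k) = ‖{kα} − {jα}‖, and let I_{j,k} ⊆ [0,1) be the geodesic joining {jα} and {kα}: writing m = min({jα},{kα}) and M = max({jα},{kα}), set I_{j,k} = [m, M) if M − m ≤ 1/2, and I_{j,k} = [0, m) ∪ [M, 1) otherwise. Define S = { d(j,k) : 1 ≤ j < k ≤ n, and for all 1 ≤ p < q ≤ n, d(p,q) < d(j,k) implies I_{p,q} ∩ I_{j,k} = ∅ }. Then |S| ≤ 3. -/
/-- `nint x` is the distance from the real number `x` to the nearest integer. -/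
noncomputable def nint (x : ℝ) : ℝ := |x - round x|

/-- The "geodesic" on the circle `[0,1)` joining two points `a, b ∈ [0,1)`:
with `m = min a b` and `M = max a b`, it is `[m, M)` if `M - m ≤ 1/2`, and
`[0, m) ∪ [M, 1)` otherwise. -/
noncomputable def geodesic (a b : ℝ) : Set ℝ :=
  if max a b - min a b ≤ 1 / 2 then Set.Ico (min a b) (max a b)
  else Set.Ico 0 (min a b) ∪ Set.Ico (max a b) 1

/-- `b` is the counterclockwise neighbour of `a` among the points `iα mod 1`, `1 ≤ i ≤ n`. -/
def IsNextPoint (α : ℝ) (n a b : ℤ) : Prop :=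
  (1 ≤ a ∧ a ≤ n) ∧ (1 ≤ b ∧ b ≤ n) ∧ a ≠ b ∧
    ∀ i : ℤ, 1 ≤ i → i ≤ n → i ≠ a →
      Int.fract (((b - a : ℤ) : ℝ) * α) ≤ Int.fract (((i - a : ℤ) : ℝ) * α)

theorem fract_sub_eq_of_fract_le {x y : ℝ} (h : Int.fract y ≤ Int.fract x) :
    Int.fract (x - y) = Int.fract x - Int.fract y := by
  rw [Int.fract_eq_iff]
  refine ⟨by linarith, by linarith [Int.fract_lt_one x, Int.fract_nonneg y], ⌊x⌋ - ⌊y⌋, ?_⟩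
  push_cast [Int.fract]
  ring

theorem Irrational.fract_intCast_mul_pos {α : ℝ} (hα : Irrational α) {m : ℤ} (hm : m ≠ 0) :
    0 < Int.fract ((m : ℝ) * α) :=
  Int.fract_pos.2 ((hα.intCast_mul hm).ne_int _)

theorem Irrational.fract_intCast_mul_inj {α : ℝ} (hα : Irrational α) {m k : ℤ}
    (h : Int.fract ((m : ℝ) * α) = Int.fract ((k : ℝ) * α)) : m = k := by
  by_contra hne
  have hpos := hα.fract_intCast_mul_pos (sub_ne_zero.2 hne)
  have hzero := fract_sub_eq_of_fract_le h.symm.le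
  rw [h, sub_self, ← sub_mul, ← Int.cast_sub] at hzero
  exact hpos.ne' hzero

theorem fract_intCast_sub_mul_eq_of_le {α : ℝ} {m k : ℤ}
    (h : Int.fract ((k : ℝ) * α) ≤ Int.fract ((m : ℝ) * α)) :
    Int.fract (((m - k : ℤ) : ℝ) * α) =
      Int.fract ((m : ℝ) * α) - Int.fract ((k : ℝ) * α) := by
  rw [← fract_sub_eq_of_fract_le h, Int.cast_sub, sub_mul]

/-- Two points have the same distance to their counterclockwise neighbour when they share it. -/
theorem IsNextPoint.le_of_same_right {α : ℝ} (hα : Irrational α) {n a a' b : ℤ}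
    (h : IsNextPoint α n a b) (h' : IsNextPoint α n a' b) :
    Int.fract (((b - a : ℤ) : ℝ) * α) ≤ Int.fract (((b - a' : ℤ) : ℝ) * α) := by
  by_contra! hlt
  have hne : a' ≠ a := by rintro rfl; exact lt_irrefl _ hlt
  have hmin := h.2.2.2 a' h'.1.1 h'.1.2 hne
  have hsub := fract_intCast_sub_mul_eq_of_le hlt.le
  rw [show b - a - (b - a') = a' - a by ring] at hsub
  have hpos := hα.fract_intCast_mul_pos (sub_ne_zero.2 h'.2.2.1.symm)
  linarith

/-- At most one arc between neighbouring points contains the point `0` in its interior. -/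
theorem IsNextPoint.le_of_zero_mem {α : ℝ} (hα : Irrational α) {n a b a' b' : ℤ}
    (h : IsNextPoint α n a b) (h' : IsNextPoint α n a' b')
    (hz' : Int.fract (((-a' : ℤ) : ℝ) * α) < Int.fract (((b' - a' : ℤ) : ℝ) * α)) :
    Int.fract (((-a' : ℤ) : ℝ) * α) ≤ Int.fract (((-a : ℤ) : ℝ) * α) := by
  by_contra! hlt
  have hne : a ≠ a' := by rintro rfl; exact lt_irrefl _ hlt
  have hmin := h'.2.2.2 a h.1.1 h.1.2 hne
  have hsub := fract_intCast_sub_mul_eq_of_le hlt.le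
  rw [show -a' - -a = a - a' by ring] at hsub
  have hpos := hα.fract_intCast_mul_pos (neg_ne_zero.2 (show a ≠ 0 by have := h.1.1; omega))
  linarith

/-- Translating an arc between neighbours by `α` until it stops being one: the last arc either
ends at the point of index `n` or has `0` in its interior. -/
theorem IsNextPoint.exists_rigid {α : ℝ} {n a b : ℤ} (h : IsNextPoint α n a b) :
    ∃ a' b', IsNextPoint α n a' b' ∧ b' - a' = b - a ∧ (a' = n ∨ b' = n ∨
      Int.fract (((-a' : ℤ) : ℝ) * α) < Int.fract (((b' - a' : ℤ) : ℝ) * α)) := by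
  by_cases hend : a = n ∨ b = n ∨
      Int.fract (((-a : ℤ) : ℝ) * α) < Int.fract (((b - a : ℤ) : ℝ) * α)
  · exact ⟨a, b, h, rfl, hend⟩
  push Not at hend
  obtain ⟨han, hbn, hz⟩ := hend
  obtain ⟨⟨ha1, ha2⟩, ⟨hb1, hb2⟩, hab, hmin⟩ := h
  have hnext : IsNextPoint α n (a + 1) (b + 1) := by
    refine ⟨⟨by omega, by omega⟩, ⟨by omega, by omega⟩, by omega, fun i hi1 hin hia => ?_⟩
    rw [show b + 1 - (a + 1) = b - a by ring, show i - (a + 1) = i - 1 - a by ring]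
    rcases hi1.eq_or_lt with rfl | hi
    · simpa using hz
    · exact hmin (i - 1) (by omega) (by omega) (by omega)
  obtain ⟨a', b', h', hdiff, hend⟩ := hnext.exists_rigid
  exact ⟨a', b', h', by omega, hend⟩
termination_by (n - a).toNat

/-- The three distance theorem: neighbouring points of `iα mod 1`, `1 ≤ i ≤ n`, determine at most
three distances. -/
theorem exists_three_gaps_cover {α : ℝ} (hα : Irrational α) (n : ℤ) :
    ∃ s : Finset ℝ, s.card ≤ 3 ∧
      ∀ a b, IsNextPoint α n a b → Int.fract (((b - a : ℤ) : ℝ) * α) ∈ s := by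
  classical
  have cover : ∀ P : ℤ → ℤ → Prop,
      (∀ a b a' b', IsNextPoint α n a b → P a b → IsNextPoint α n a' b' → P a' b' →
        Int.fract (((b - a : ℤ) : ℝ) * α) = Int.fract (((b' - a' : ℤ) : ℝ) * α)) →
      ∃ c : ℝ, ∀ a b, IsNextPoint α n a b → P a b → Int.fract (((b - a : ℤ) : ℝ) * α) = c := by
    intro P hP
    by_cases hex : ∃ a b, IsNextPoint α n a b ∧ P a b
    · obtain ⟨a, b, h, hp⟩ := hex
      exact ⟨_, fun a' b' h' hp' => hP a' b' a b h' hp' h hp⟩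
    · exact ⟨0, fun a b h hp => absurd ⟨a, b, h, hp⟩ hex⟩
  have same_left : ∀ a b b', IsNextPoint α n a b → IsNextPoint α n a b' →
      Int.fract (((b - a : ℤ) : ℝ) * α) = Int.fract (((b' - a : ℤ) : ℝ) * α) :=
    fun a b b' h h' => le_antisymm (h.2.2.2 b' h'.2.1.1 h'.2.1.2 h'.2.2.1.symm)
      (h'.2.2.2 b h.2.1.1 h.2.1.2 h.2.2.1.symm)
  obtain ⟨c₁, hc₁⟩ := cover (fun a _ => a = n) (by
    rintro a b a' b' h rfl h' rfl
    exact same_left _ _ _ h h')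
  obtain ⟨c₂, hc₂⟩ := cover (fun _ b => b = n) (by
    rintro a b a' b' h rfl h' rfl
    exact le_antisymm (h.le_of_same_right hα h') (h'.le_of_same_right hα h))
  obtain ⟨c₃, hc₃⟩ := cover (fun a b =>
      Int.fract (((-a : ℤ) : ℝ) * α) < Int.fract (((b - a : ℤ) : ℝ) * α)) (by
    intro a b a' b' h hz h' hz'
    obtain rfl : a = a' := neg_injective <| hα.fract_intCast_mul_inj <|
      le_antisymm (h'.le_of_zero_mem hα h hz) (h.le_of_zero_mem hα h' hz')
    exact same_left _ _ _ h h')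
  refine ⟨{c₁, c₂, c₃}, Finset.card_le_three, fun a b h => ?_⟩
  obtain ⟨a', b', h', hdiff, hend⟩ := h.exists_rigid
  rw [← hdiff]
  rcases hend with hend | hend | hend
  · rw [hc₁ a' b' h' hend]
    simp
  · rw [hc₂ a' b' h' hend]
    simp
  · rw [hc₃ a' b' h' hend]
    simp

theorem geodesic_comm (a b : ℝ) : geodesic a b = geodesic b a := by
  simp only [geodesic, min_comm a b, max_comm a b]

theorem nint_eq_min (x : ℝ) : nint x = min (Int.fract x) (1 - Int.fract x) :=
  abs_sub_round_eq_min x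

theorem nint_neg (x : ℝ) : nint (-x) = nint x := by
  rw [nint_eq_min, nint_eq_min]
  by_cases hx : Int.fract x = 0
  · rw [Int.fract_neg_eq_zero.2 hx, hx]
  · rw [Int.fract_neg hx, sub_sub_cancel, min_comm]

theorem nint_sub_comm (x y : ℝ) : nint (x - y) = nint (y - x) := by
  rw [← nint_neg, neg_sub]

theorem left_mem_geodesic {x y : ℝ} (hx : 0 ≤ x ∧ x < 1) (hy : 0 ≤ y ∧ y < 1) (hne : x ≠ y)
    (h : Int.fract (y - x) < 1 / 2) : x ∈ geodesic x y := by
  rcases hne.lt_or_gt with hlt | hlt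
  · rw [Int.fract_eq_self.2 ⟨by linarith, by linarith⟩] at h
    rw [geodesic, min_eq_left hlt.le, max_eq_right hlt.le, if_pos h.le]
    exact ⟨le_rfl, hlt⟩
  · rw [← Int.fract_add_one, Int.fract_eq_self.2 ⟨by linarith, by linarith⟩] at h
    rw [geodesic, min_eq_right hlt.le, max_eq_left hlt.le, if_neg (by linarith)]
    exact Or.inr ⟨le_rfl, hx.2⟩

theorem fract_fract_mul_sub (α : ℝ) (a b : ℕ) :
    Int.fract (Int.fract ((b : ℝ) * α) - Int.fract ((a : ℝ) * α)) =
      Int.fract ((((b : ℤ) - a : ℤ) : ℝ) * α) := by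
  rw [Int.fract_eq_fract]
  refine ⟨⌊(a : ℝ) * α⌋ - ⌊(b : ℝ) * α⌋, ?_⟩
  push_cast [Int.fract]
  ring

/-- A short arc whose geodesic meets no geodesic of a strictly shorter pair joins neighbours. -/
theorem isNextPoint_of_undefeated {α : ℝ} (hα : Irrational α) {n a b : ℕ}
    (ha : 1 ≤ a ∧ a ≤ n) (hb : 1 ≤ b ∧ b ≤ n) (hab : a ≠ b)
    (hshort : Int.fract ((((b : ℤ) - a : ℤ) : ℝ) * α) < 1 / 2)
    (h : ∀ p q : ℕ, 1 ≤ p → p ≤ n → 1 ≤ q → q ≤ n → p ≠ q →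
      nint (Int.fract ((q : ℝ) * α) - Int.fract ((p : ℝ) * α)) <
          nint (Int.fract ((b : ℝ) * α) - Int.fract ((a : ℝ) * α)) →
        geodesic (Int.fract ((p : ℝ) * α)) (Int.fract ((q : ℝ) * α)) ∩
          geodesic (Int.fract ((a : ℝ) * α)) (Int.fract ((b : ℝ) * α)) = ∅) :
    IsNextPoint α n a b := by
  have left_mem : ∀ q : ℕ, a ≠ q → Int.fract ((((q : ℤ) - a : ℤ) : ℝ) * α) < 1 / 2 →
      Int.fract ((a : ℝ) * α) ∈
        geodesic (Int.fract ((a : ℝ) * α)) (Int.fract ((q : ℝ) * α)) := by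
    intro q hq hlt
    refine left_mem_geodesic ⟨Int.fract_nonneg _, Int.fract_lt_one _⟩
      ⟨Int.fract_nonneg _, Int.fract_lt_one _⟩ (fun heq => hq ?_)
      (by rwa [fract_fract_mul_sub])
    exact_mod_cast hα.fract_intCast_mul_inj (m := a) (k := q) (by exact_mod_cast heq)
  refine ⟨by omega, by omega, by omega, fun i hi1 hin hia => ?_⟩
  lift i to ℕ using by omega
  by_contra! hlt
  have hai : a ≠ i := by omega
  have hdisj := h a i ha.1 ha.2 (by omega) (by omega) hai (by
    rw [nint_eq_min, nint_eq_min, fract_fract_mul_sub, fract_fract_mul_sub,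
      min_eq_left (by linarith), min_eq_left (by linarith)]
    exact hlt)
  exact (Set.eq_empty_iff_forall_notMem.1 hdisj) _
    ⟨left_mem i hai (hlt.trans hshort), left_mem b hab hshort⟩

/-- Reformulation of the three distance theorem: the set of distances `‖{kα} − {jα}‖`
over pairs `1 ≤ j < k ≤ n` that are not "defeated" by any strictly shorter pair with
overlapping geodesic has at most 3 elements. -/
theorem three_distance_reformulated (α : ℝ) (hα : Irrational α) (n : ℕ) (hn : 1 ≤ n) :
    Set.ncard { d : ℝ | ∃ j k : ℕ, 1 ≤ j ∧ j < k ∧ k ≤ n ∧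
        d = nint (Int.fract ((k : ℝ) * α) - Int.fract ((j : ℝ) * α)) ∧
        ∀ p q : ℕ, 1 ≤ p → p < q → q ≤ n →
          nint (Int.fract ((q : ℝ) * α) - Int.fract ((p : ℝ) * α))
              < nint (Int.fract ((k : ℝ) * α) - Int.fract ((j : ℝ) * α)) →
            geodesic (Int.fract ((p : ℝ) * α)) (Int.fract ((q : ℝ) * α)) ∩
              geodesic (Int.fract ((j : ℝ) * α)) (Int.fract ((k : ℝ) * α)) = ∅ } ≤ 3 := by
  obtain ⟨s, hs, hcover⟩ := exists_three_gaps_cover hα n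
  refine (Set.ncard_le_ncard (t := (s : Set ℝ)) ?_ s.finite_toSet).trans
    ((Set.ncard_coe_finset s).trans_le hs)
  rintro d ⟨j, k, hj, hjk, hk, rfl, h⟩
  have hsymm : ∀ p q : ℕ, 1 ≤ p → p ≤ n → 1 ≤ q → q ≤ n → p ≠ q →
      nint (Int.fract ((q : ℝ) * α) - Int.fract ((p : ℝ) * α)) <
          nint (Int.fract ((k : ℝ) * α) - Int.fract ((j : ℝ) * α)) →
        geodesic (Int.fract ((p : ℝ) * α)) (Int.fract ((q : ℝ) * α)) ∩
          geodesic (Int.fract ((j : ℝ) * α)) (Int.fract ((k : ℝ) * α)) = ∅ := by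
    intro p q hp hpn hq hqn hpq hlt
    rcases hpq.lt_or_gt with hpq | hpq
    · exact h p q hp hpq hqn hlt
    · rw [geodesic_comm (Int.fract ((p : ℝ) * α))]
      exact h q p hq hpq hpn (by rwa [nint_sub_comm])
  have hne : (k : ℤ) - j ≠ 0 := by omega
  have hneg : Int.fract ((((j : ℤ) - k : ℤ) : ℝ) * α) =
      1 - Int.fract ((((k : ℤ) - j : ℤ) : ℝ) * α) := by
    rw [← Int.fract_neg (hα.fract_intCast_mul_pos hne).ne']
    congr 1
    push_cast
    ring
  have hhalf : Int.fract ((((k : ℤ) - j : ℤ) : ℝ) * α) ≠ 1 / 2 := by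
    intro heq
    have := hα.fract_intCast_mul_inj (heq.trans (by rw [hneg, heq]; norm_num :
      (1 / 2 : ℝ) = Int.fract ((((j : ℤ) - k : ℤ) : ℝ) * α)))
    omega
  rcases hhalf.lt_or_gt with hlt | hgt
  · rw [nint_eq_min, fract_fract_mul_sub, min_eq_left (by linarith)]
    exact hcover j k (isNextPoint_of_undefeated hα ⟨hj, by omega⟩ ⟨by omega, hk⟩ hjk.ne hlt hsymm)
  · rw [nint_eq_min, fract_fract_mul_sub, min_eq_right (by linarith), ← hneg]
    refine hcover k j (isNextPoint_of_undefeated hα ⟨by omega, hk⟩ ⟨hj, by omega⟩ hjk.ne'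
      (by linarith) ?_)
    rw [nint_sub_comm, geodesic_comm (Int.fract ((k : ℝ) * α))]
    exact hsymm
end

section
/- Let α, λ₁, λ₂, …, λ_d be real numbers and n₁, n₂, …, n_d positive integers. Consider the finite set F = { {kα + λᵢ} : 1 ≤ i ≤ d, 1 ≤ k ≤ nᵢ } of points on the circle [0,1). Then the set of distinct gap lengths between circularly consecutive elements of F (i.e., differences between consecutive elements of F in increasing order, together with the wrap-around gap 1 minus the largest element plus the smallest element) has at most 3d elements. -/
/-- The lift to `ℝ` of the set of points `kα + λᵢ` (`1 ≤ k ≤ nᵢ`) of the circle `ℝ/ℤ`. -/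
def orbitLift {d : ℕ} (α : ℝ) (lam : Fin d → ℝ) (n : Fin d → ℕ) : Set ℝ :=
  {y | ∃ i : Fin d, ∃ k : ℕ, 1 ≤ k ∧ k ≤ n i ∧ ∃ m : ℤ, y = k * α + lam i + m}

/-- `x` and `x + g` are consecutive elements of `S`. -/
def IsGap (S : Set ℝ) (x g : ℝ) : Prop :=
  0 < g ∧ x ∈ S ∧ x + g ∈ S ∧ ∀ s, 0 < s → s < g → x + s ∉ S

namespace IsGap

variable {S : Set ℝ} {x x' y g g' : ℝ}

theorem not_mem (h : IsGap S x g) (h1 : x < y) (h2 : y < x + g) : y ∉ S := by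
  have := h.2.2.2 (y - x) (by linarith) (by linarith)
  rwa [add_sub_cancel] at this

theorem length_unique (h : IsGap S x g) (h' : IsGap S x g') : g = g' := by
  rcases lt_trichotomy g g' with hlt | heq | hlt
  · exact absurd h.2.2.1 (h'.2.2.2 g h.1 hlt)
  · exact heq
  · exact absurd h'.2.2.1 (h.2.2.2 g' h'.1 hlt)

theorem length_unique_right (h : IsGap S (y - g) g) (h' : IsGap S (y - g') g') : g = g' := by
  rcases lt_trichotomy g g' with hlt | heq | hlt
  · exact absurd h.2.1 (h'.not_mem (by linarith) (by linarith [h.1]))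
  · exact heq
  · exact absurd h'.2.1 (h.not_mem (by linarith) (by linarith [h'.1]))

theorem length_unique_interior (h : IsGap S x g) (h' : IsGap S x' g')
    (hx : x < y) (hy : y < x + g) (hx' : x' < y) (hy' : y < x' + g') : g = g' := by
  rcases lt_trichotomy x x' with hlt | rfl | hlt
  · exact absurd h'.2.1 (h.not_mem hlt (by linarith))
  · exact h.length_unique h'
  · exact absurd h.2.1 (h'.not_mem hlt (by linarith))

end IsGap

section orbitLift

variable {d : ℕ} {α : ℝ} {lam : Fin d → ℝ} {n : Fin d → ℕ}

theorem add_intCast_mem_orbitLift {y : ℝ} (h : y ∈ orbitLift α lam n) (m : ℤ) :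
    y + m ∈ orbitLift α lam n := by
  obtain ⟨i, k, h1, h2, m', rfl⟩ := h
  exact ⟨i, k, h1, h2, m' + m, by push_cast; ring⟩

theorem IsGap.add_intCast {x g : ℝ} (h : IsGap (orbitLift α lam n) x g) (m : ℤ) :
    IsGap (orbitLift α lam n) (x + m) g := by
  obtain ⟨h0, h1, h2, h3⟩ := h
  refine ⟨h0, add_intCast_mem_orbitLift h1 m, ?_, fun s hs hsg hmem => h3 s hs hsg ?_⟩
  · rw [add_right_comm]
    exact add_intCast_mem_orbitLift h2 m
  · have := add_intCast_mem_orbitLift hmem (-m)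
    push_cast at this
    rwa [show x + m + s + -m = x + s by ring] at this

/-- A gap length is attained at a gap that begins or ends at the last point of a progression,
or that contains the point preceding the first point of a progression. -/
theorem IsGap.exists_extremal {x g : ℝ} (h : IsGap (orbitLift α lam n) x g) :
    ∃ i : Fin d, IsGap (orbitLift α lam n) (n i * α + lam i) g ∨
      IsGap (orbitLift α lam n) (n i * α + lam i - g) g ∨
      ∃ x', x' < lam i ∧ lam i < x' + g ∧ IsGap (orbitLift α lam n) x' g := by
  obtain ⟨i, k, hk1, hkn, m, hx⟩ := h.2.1
  induction hkn using Nat.decreasingInduction generalizing x with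
  | self =>
    refine ⟨i, Or.inl ?_⟩
    have := h.add_intCast (-m)
    push_cast at this
    rwa [show x + -m = n i * α + lam i by rw [hx]; ring] at this
  | of_succ k hk ih =>
    obtain ⟨j, l, hl1, hln, m', hy⟩ := h.2.2.1
    rcases hln.eq_or_lt with rfl | hln
    · refine ⟨j, Or.inr (Or.inl ?_)⟩
      have := h.add_intCast (-m')
      push_cast at this
      rwa [show x + -m' = n j * α + lam j - g by linarith] at this
    by_cases hfirst : ∃ j : Fin d, ∃ s, 0 < s ∧ s < g ∧ ∃ m : ℤ, x + s = lam j + m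
    · obtain ⟨j, s, hs, hsg, m, hm⟩ := hfirst
      have := h.add_intCast (-m)
      push_cast at this
      exact ⟨j, Or.inr (Or.inr ⟨_, by linarith, by linarith, this⟩)⟩
    have hx' : x + α = (k + 1 : ℕ) * α + lam i + m := by rw [hx]; push_cast; ring
    refine ih (x := x + α) ⟨h.1, ⟨i, k + 1, by omega, hk, m, hx'⟩,
      ⟨j, l + 1, by omega, hln, m', by push_cast; linarith⟩, ?_⟩ (by omega) hx'
    rintro s hs hsg ⟨j', p, hp1, hpn, m'', hp⟩
    obtain ⟨p, rfl⟩ := Nat.exists_eq_add_of_le' hp1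
    push_cast at hp
    rcases Nat.eq_zero_or_pos p with rfl | hp0
    · exact hfirst ⟨j', s, hs, hsg, m'', by push_cast at hp; linarith⟩
    · exact h.2.2.2 s hs hsg ⟨j', p, hp0, by omega, m'', by linarith⟩

theorem card_le_of_forall_isGap (A : Finset ℝ)
    (hA : ∀ g ∈ A, ∃ x, IsGap (orbitLift α lam n) x g) : A.card ≤ 3 * d := by
  let S := orbitLift α lam n
  let r : ℝ → Fin 3 × Fin d → Prop := fun g p =>
    ![IsGap S (n p.2 * α + lam p.2) g, IsGap S (n p.2 * α + lam p.2 - g) g,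
      ∃ x', x' < lam p.2 ∧ lam p.2 < x' + g ∧ IsGap S x' g] p.1
  have key : A.card ≤ (Finset.univ : Finset (Fin 3 × Fin d)).card := by
    refine Finset.card_le_card_of_forall_subsingleton r (fun g hg => ?_) ?_
    · obtain ⟨x, hx⟩ := hA g hg
      obtain ⟨i, h | h | h⟩ := hx.exists_extremal
      · exact ⟨(0, i), Finset.mem_univ _, h⟩
      · exact ⟨(1, i), Finset.mem_univ _, h⟩
      · exact ⟨(2, i), Finset.mem_univ _, h⟩
    · rintro ⟨c, i⟩ - g ⟨-, hg⟩ g' ⟨-, hg'⟩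
      fin_cases c
      · exact IsGap.length_unique hg hg'
      · exact IsGap.length_unique_right hg hg'
      · obtain ⟨x, h1, h2, h⟩ := hg
        obtain ⟨x', h1', h2', h'⟩ := hg'
        exact h.length_unique_interior h' h1 h2 h1' h2'
  simpa using key

theorem mem_orbitLift_iff_fract_mem {y : ℝ} :
    y ∈ orbitLift α lam n ↔ Int.fract y ∈ Finset.univ.biUnion fun i : Fin d =>
      (Finset.Icc 1 (n i)).image fun k : ℕ => Int.fract ((k : ℝ) * α + lam i) := by
  simp only [orbitLift, Set.mem_ofPred_eq, Finset.mem_biUnion, Finset.mem_univ, true_and,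
    Finset.mem_image, Finset.mem_Icc, Int.fract_eq_fract, and_assoc]
  constructor
  · rintro ⟨i, k, h1, h2, m, rfl⟩
    exact ⟨i, k, h1, h2, -m, by push_cast; ring⟩
  · rintro ⟨i, k, h1, h2, m, hm⟩
    exact ⟨i, k, h1, h2, -m, by push_cast; linarith⟩

end orbitLift


/-- The Chung–Graham generalisation of the three distance theorem: for the set
`F = { {kα + λᵢ} : 1 ≤ i ≤ d, 1 ≤ k ≤ nᵢ }` of points on the circle `[0,1)`,
enumerated in increasing order by `t 1 < ⋯ < t N` (`N = |F|`), the set of gaps between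
circularly consecutive points (including the wrap-around gap `1 - t N + t 1`) has at most
`3d` elements. -/
theorem chung_graham (d : ℕ) (hd : 1 ≤ d) (α : ℝ) (lam : Fin d → ℝ)
    (n : Fin d → ℕ) (hn : ∀ i, 1 ≤ n i)
    (F : Finset ℝ)
    (hF : F = Finset.univ.biUnion fun i : Fin d =>
      (Finset.Icc 1 (n i)).image fun k : ℕ => Int.fract ((k : ℝ) * α + lam i))
    (N : ℕ) (hN : N = F.card)
    (t : ℕ → ℝ) (ht : StrictMonoOn t (Set.Icc 1 N))
    (himg : (Finset.Icc 1 N).image t = F) :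
    ((Finset.Icc 1 N).image fun k =>
        if k = N then 1 - t N + t 1 else t (k + 1) - t k).card ≤ 3 * d := by
  subst hF
  set F := Finset.univ.biUnion fun i : Fin d =>
      (Finset.Icc 1 (n i)).image fun k : ℕ => Int.fract ((k : ℝ) * α + lam i) with hF
  have hmem : ∀ y, y ∈ orbitLift α lam n ↔ Int.fract y ∈ F := fun y =>
    mem_orbitLift_iff_fract_mem
  have htF : ∀ k, 1 ≤ k → k ≤ N → t k ∈ F := fun k h1 h2 => by
    rw [← himg]
    exact Finset.mem_image_of_mem t (Finset.mem_Icc.2 ⟨h1, h2⟩)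
  have hFt : ∀ y ∈ F, ∃ k, 1 ≤ k ∧ k ≤ N ∧ t k = y := fun y hy => by
    rw [← himg] at hy
    simpa [and_assoc] using hy
  have hrange : ∀ y ∈ F, 0 ≤ y ∧ y < 1 := fun y hy => by
    simp only [hF, Finset.mem_biUnion, Finset.mem_image] at hy
    obtain ⟨i, -, k, -, rfl⟩ := hy
    exact ⟨Int.fract_nonneg _, Int.fract_lt_one _⟩
  have hself : ∀ y, 0 ≤ y → y < 1 → (y ∈ orbitLift α lam n ↔ y ∈ F) := fun y h0 h1 => by
    rw [hmem, Int.fract_eq_self.2 ⟨h0, h1⟩]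
  have htS : ∀ k, 1 ≤ k → k ≤ N → t k ∈ orbitLift α lam n := fun k h1 h2 =>
    have hk := htF k h1 h2
    (hself _ (hrange _ hk).1 (hrange _ hk).2).2 hk
  refine card_le_of_forall_isGap (α := α) (lam := lam) (n := n) _ fun g hg => ?_
  obtain ⟨k, hk, rfl⟩ := Finset.mem_image.1 hg
  obtain ⟨hk1, hkN⟩ := Finset.mem_Icc.1 hk
  refine ⟨t k, ?_⟩
  have hk01 := hrange _ (htF k hk1 hkN)
  split_ifs with hkeq
  · subst hkeq
    have h101 := hrange _ (htF 1 le_rfl hk1)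
    refine ⟨by linarith, htS k hk1 le_rfl, ?_, fun s hs hsg hS => ?_⟩
    · have := add_intCast_mem_orbitLift (htS 1 le_rfl hk1) 1
      push_cast at this
      rwa [show t k + (1 - t k + t 1) = t 1 + 1 by ring]
    · rcases lt_or_ge (t k + s) 1 with hlt | hge
      · obtain ⟨j, hj1, hjk, hj⟩ := hFt _ ((hself _ (by linarith) hlt).1 hS)
        have := ht.monotoneOn ⟨hj1, hjk⟩ ⟨hk1, le_rfl⟩ hjk
        linarith
      · have hS' := add_intCast_mem_orbitLift hS (-1)
        push_cast at hS'
        obtain ⟨j, hj1, hjk, hj⟩ := hFt _ ((hself _ (by linarith) (by linarith)).1 hS')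
        have := ht.monotoneOn ⟨le_rfl, hk1⟩ ⟨hj1, hjk⟩ hj1
        linarith
  · have hkN' : k + 1 ≤ N := by omega
    have hk01' := hrange _ (htF (k + 1) (by omega) hkN')
    have hlt := ht ⟨hk1, hkN⟩ ⟨by omega, hkN'⟩ k.lt_succ_self
    refine ⟨by linarith, htS k hk1 hkN, ?_, fun s hs hsg hS => ?_⟩
    · rw [add_sub_cancel]
      exact htS (k + 1) (by omega) hkN'
    · obtain ⟨j, hj1, hjN, hj⟩ := hFt _ ((hself _ (by linarith) (by linarith)).1 hS)
      have hkj : k < j := (ht.lt_iff_lt ⟨hk1, hkN⟩ ⟨hj1, hjN⟩).1 (by linarith)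
      have := ht.monotoneOn ⟨by omega, hkN'⟩ ⟨hj1, hjN⟩ hkj
      linarith
end

section
/- Let α and β be real numbers and n ≥ 2 an integer. For a positive integer q define ℓ(q) = √(‖qα‖² + ‖qβ‖²). Let Q₁ be the least integer in {1, …, ⌊n/2⌋} such that ℓ(Q₁) ≤ ℓ(q) for all integers q with 1 ≤ q ≤ n/2. Then the set { ℓ(q) : q an integer, n/2 < q ≤ n, ℓ(q) < ℓ(Q₁) } has at most 5 elements. -/
/-- `len2 α β q = √(‖qα‖² + ‖qβ‖²)`, the length of the integer `q` w.r.t. `(α, β)`. -/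
noncomputable def len2 (α β : ℝ) (q : ℕ) : ℝ :=
  Real.sqrt (nint ((q : ℝ) * α) ^ 2 + nint ((q : ℝ) * β) ^ 2)

/-- Two points of an open disc of radius `R` about the origin that are at distance at least `R`
are seen from the origin under an angle larger than `π / 3`. -/
theorem pi_div_three_lt_abs_arg_sub_arg {z w : ℂ} {R : ℝ} (hz : ‖z‖ < R) (hw : ‖w‖ < R)
    (hzw : R ≤ ‖z - w‖) : Real.pi / 3 < |Complex.arg z - Complex.arg w| := by
  by_contra! h
  have hcos : 1 / 2 ≤ Real.cos (Complex.arg z - Complex.arg w) := by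
    rw [← Real.cos_abs, ← Real.cos_pi_div_three]
    exact Real.cos_le_cos_of_nonneg_of_le_pi (abs_nonneg _) (by linarith [Real.pi_pos]) h
  have hR : 0 ≤ R := (norm_nonneg z).trans hz.le
  have hexp : ‖z - w‖ ^ 2 =
      ‖z‖ ^ 2 + ‖w‖ ^ 2 - 2 * (‖z‖ * ‖w‖ * Real.cos (Complex.arg z - Complex.arg w)) := by
    have hdot : ‖z‖ * ‖w‖ * Real.cos (Complex.arg z - Complex.arg w) =
        z.re * w.re + z.im * w.im := by
      rw [Real.cos_sub, ← Complex.norm_mul_cos_arg z, ← Complex.norm_mul_cos_arg w,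
        ← Complex.norm_mul_sin_arg z, ← Complex.norm_mul_sin_arg w]
      ring
    rw [hdot]
    simp only [Complex.sq_norm, Complex.normSq_apply, Complex.sub_re, Complex.sub_im]
    ring
  have hprod := mul_le_mul_of_nonneg_left hcos (mul_nonneg (norm_nonneg z) (norm_nonneg w))
  have hsq : R ^ 2 ≤ ‖z - w‖ ^ 2 := pow_le_pow_left₀ hR hzw 2
  rcases le_total ‖z‖ ‖w‖ with hle | hle
  · nlinarith [mul_nonneg (norm_nonneg z) (sub_nonneg.2 hle), norm_nonneg w]
  · nlinarith [mul_nonneg (norm_nonneg w) (sub_nonneg.2 hle), norm_nonneg z]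

/-- An open disc of radius `L` about the origin contains at most five points with pairwise
distances at least `L`. -/
theorem card_le_five_of_separated {ι : Type*} (s : Finset ι) (f : ι → ℂ) {L : ℝ}
    (hlt : ∀ i ∈ s, ‖f i‖ < L) (hsep : ∀ i ∈ s, ∀ j ∈ s, i ≠ j → L ≤ ‖f i - f j‖) :
    s.card ≤ 5 := by
  classical
  by_cases hs : s.card ≤ 1
  · omega
  obtain ⟨i₀, hi₀, j₀, hj₀, hij₀⟩ := Finset.one_lt_card.1 (not_le.1 hs)
  have hc : f i₀ ≠ 0 := fun h => by
    have := hsep j₀ hj₀ i₀ hi₀ hij₀.symm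
    rw [h, sub_zero] at this
    exact absurd (hlt j₀ hj₀) (not_lt.2 this)
  have hcpos : 0 < ‖f i₀‖ := norm_pos_iff.2 hc
  set t : ι → ℝ := fun i => Complex.arg (f i / f i₀) / (Real.pi / 3) with ht
  have hpi : 0 < Real.pi / 3 := by positivity
  have ht_sep : ∀ i ∈ s, ∀ j ∈ s, i ≠ j → 1 < |t i - t j| := by
    intro i hi j hj hij
    have h := pi_div_three_lt_abs_arg_sub_arg (z := f i / f i₀) (w := f j / f i₀)
      (R := L / ‖f i₀‖) (by rw [norm_div]; gcongr; exact hlt i hi)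
      (by rw [norm_div]; gcongr; exact hlt j hj)
      (by rw [← sub_div, norm_div]; gcongr; exact hsep i hi j hj hij)
    rwa [ht, ← sub_div, abs_div, abs_of_pos hpi, one_lt_div hpi]
  have ht₀ : t i₀ = 0 := by simp [ht, div_self hc]
  have hmaps : ∀ i ∈ s, ⌈t i⌉ ∈ ({-2, -1, 0, 2, 3} : Finset ℤ) := by
    intro i hi
    by_cases h : i = i₀
    · simp [h, ht₀]
    have hsep₀ := ht_sep i hi i₀ hi₀ h
    rw [ht₀, sub_zero] at hsep₀
    have hlo : -3 < t i := by
      rw [ht, lt_div_iff₀ hpi]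
      linarith [Complex.neg_pi_lt_arg (f i / f i₀)]
    have hhi : t i ≤ 3 := by
      rw [ht, div_le_iff₀ hpi]
      linarith [Complex.arg_le_pi (f i / f i₀)]
    have hhi' : ⌈t i⌉ ≤ 3 := Int.ceil_le.2 (by exact_mod_cast hhi)
    have hlo' : -3 < ⌈t i⌉ := Int.lt_ceil.2 (by exact_mod_cast hlo)
    simp only [Finset.mem_insert, Finset.mem_singleton]
    rcases lt_abs.1 hsep₀ with h1 | h1
    · have : 1 < ⌈t i⌉ := Int.lt_ceil.2 (by exact_mod_cast h1)
      omega
    · have : ⌈t i⌉ ≤ -1 := Int.ceil_le.2 (by push_cast; linarith)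
      omega
  have hinj : Set.InjOn (fun i => ⌈t i⌉) s := by
    intro i hi j hj hij
    by_contra hne
    refine absurd (ht_sep i hi j hj hne) (not_lt.2 (abs_le.2 ?_))
    have hij' : (⌈t i⌉ : ℝ) = ⌈t j⌉ := congrArg _ hij
    constructor <;>
      linarith [Int.le_ceil (t i), Int.ceil_lt_add_one (t i), Int.le_ceil (t j),
        Int.ceil_lt_add_one (t j)]
  exact Finset.card_le_card_of_injOn _ hmaps hinj

/-- The representative of `(q α, q β)` modulo `ℤ²` in the square centred at the origin. -/
noncomputable def residue (α β : ℝ) (q : ℕ) : ℂ :=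
  ⟨q * α - round (q * α), q * β - round (q * β)⟩

theorem norm_residue (α β : ℝ) (q : ℕ) : ‖residue α β q‖ = len2 α β q := by
  rw [Complex.norm_eq_sqrt_sq_add_sq]
  simp [residue, len2, nint]

theorem nint_sq_le (x : ℝ) (m : ℤ) : nint x ^ 2 ≤ (x - m) ^ 2 := by
  rw [nint, ← sq_abs (x - m)]
  exact pow_le_pow_left₀ (abs_nonneg _) (round_le x m) 2

theorem len2_sub_le_norm_residue_sub (α β : ℝ) {q r : ℕ} (h : r ≤ q) :
    len2 α β (q - r) ≤ ‖residue α β q - residue α β r‖ := by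
  rw [Complex.norm_eq_sqrt_sq_add_sq, len2]
  refine Real.sqrt_le_sqrt (add_le_add ?_ ?_)
  · refine (nint_sq_le _ (round (q * α) - round (r * α))).trans_eq ?_
    simp only [residue, Complex.sub_re]
    push_cast [h]
    ring
  · refine (nint_sq_le _ (round (q * β) - round (r * β))).trans_eq ?_
    simp only [residue, Complex.sub_im]
    push_cast [h]
    ring

/-- Lemma 1 of the paper: if `Q₁` is the least integer in `{1, …, ⌊n/2⌋}` minimising the
length `ℓ` among `1 ≤ q ≤ n/2`, then the lengths of primary denominators
(`n/2 < q ≤ n` with `ℓ(q) < ℓ(Q₁)`) take at most five distinct values. -/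
theorem primary_lengths_at_most_five (α β : ℝ) (n : ℕ) (hn : 2 ≤ n) (Q₁ : ℕ)
    (hQ₁ : IsLeast {q : ℕ | (1 ≤ q ∧ 2 * q ≤ n) ∧
      ∀ q' : ℕ, 1 ≤ q' → 2 * q' ≤ n → len2 α β q ≤ len2 α β q'} Q₁) :
    Set.ncard {x : ℝ | ∃ q : ℕ, n < 2 * q ∧ q ≤ n ∧ len2 α β q < len2 α β Q₁ ∧
      x = len2 α β q} ≤ 5 := by
  classical
  set s : Finset ℕ := (Finset.range (n + 1)).filter
    fun q => n < 2 * q ∧ len2 α β q < len2 α β Q₁ with hs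
  have hset : {x : ℝ | ∃ q : ℕ, n < 2 * q ∧ q ≤ n ∧ len2 α β q < len2 α β Q₁ ∧
      x = len2 α β q} = s.image (len2 α β) := by
    ext x
    simp only [hs, Set.mem_ofPred_eq, Finset.coe_image, Set.mem_image, Finset.mem_coe,
      Finset.mem_filter, Finset.mem_range, Nat.lt_succ_iff]
    grind
  rw [hset, Set.ncard_coe_finset]
  refine Finset.card_image_le.trans
    (card_le_five_of_separated s (residue α β) (L := len2 α β Q₁) ?_ ?_)
  · intro q hq
    rw [norm_residue]
    exact (Finset.mem_filter.1 hq).2.2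
  · intro q hq r hr hqr
    simp only [hs, Finset.mem_filter, Finset.mem_range] at hq hr
    rcases lt_or_gt_of_ne hqr with h | h
    · rw [norm_sub_rev]
      exact (hQ₁.1.2 (r - q) (by omega) (by omega)).trans
        (len2_sub_le_norm_residue_sub α β h.le)
    · exact (hQ₁.1.2 (q - r) (by omega) (by omega)).trans
        (len2_sub_le_norm_residue_sub α β h.le)
end

section
/- Let α and β be real numbers and n ≥ 2 an integer, and for a positive integer q define ℓ(q) = √(‖qα‖² + ‖qβ‖²). Say an integer q has type (s₁, s₂) ∈ {+,−}² where s₁ is + if {qα} ≥ 1/2 and − otherwise, and s₂ is + if {qβ} ≥ 1/2 and − otherwise. Let Q₁ be the least integer in {1, …, ⌊n/2⌋} with ℓ(Q₁) ≤ ℓ(q) for all integers 1 ≤ q ≤ n/2. Let Q₁^⊥ = { q : 1 ≤ q ≤ n − Q₁, q does not have the same type as Q₁ }, assume Q₁^⊥ is nonempty, and let Q₂ be the least integer in Q₁^⊥ such that ℓ(Q₂) ≤ ℓ(q) for all q ∈ Q₁^⊥. Then there is at most one integer q with 1 ≤ q < Q₁ and ℓ(q) < ℓ(Q₂). -/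
open scoped Classical

/-- The type of an integer `q` w.r.t. `(α, β)`: the pair of signs of
`{qα} − 1/2` and `{qβ} − 1/2` (`true` = `+`, `false` = `−`). -/
noncomputable def typ2 (α β : ℝ) (q : ℕ) : Bool × Bool :=
  (if 1 / 2 ≤ Int.fract ((q : ℝ) * α) then true else false,
   if 1 / 2 ≤ Int.fract ((q : ℝ) * β) then true else false)

/-- The signed distance from `x` to the nearest integer. -/
noncomputable def sres (x : ℝ) : ℝ := x - round x

lemma sres_neg_of_half_le_fract {x : ℝ} (h : 1 / 2 ≤ Int.fract x) :
    -(1 / 2) ≤ sres x ∧ sres x < 0 := by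
  have hceil : (⌈x⌉ : ℝ) = x + 1 - Int.fract x :=
    Int.ceil_eq_add_one_sub_fract (by linarith)
  have hround : round x = ⌈x⌉ := by rw [round, if_neg (by linarith)]
  have := Int.fract_lt_one x
  constructor <;> rw [sres, hround, hceil] <;> linarith

lemma sres_nonneg_of_fract_lt_half {x : ℝ} (h : Int.fract x < 1 / 2) :
    0 ≤ sres x ∧ sres x < 1 / 2 := by
  have hround : round x = ⌊x⌋ := by rw [round, if_pos (by linarith)]
  rw [sres, hround, Int.self_sub_floor]
  exact ⟨Int.fract_nonneg x, h⟩

lemma sres_mul_nonneg {x y : ℝ} (h : 1 / 2 ≤ Int.fract x ↔ 1 / 2 ≤ Int.fract y) :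
    0 ≤ sres x * sres y := by
  by_cases hx : 1 / 2 ≤ Int.fract x
  · exact mul_nonneg_of_nonpos_of_nonpos (sres_neg_of_half_le_fract hx).2.le
      (sres_neg_of_half_le_fract (h.1 hx)).2.le
  · exact mul_nonneg (sres_nonneg_of_fract_lt_half (not_le.1 hx)).1
      (sres_nonneg_of_fract_lt_half (not_le.1 fun hy => hx (h.2 hy))).1

lemma sres_sub {x y : ℝ} (h : 1 / 2 ≤ Int.fract x ↔ 1 / 2 ≤ Int.fract y) :
    sres (x - y) = sres x - sres y := by
  have hlt : -(1 / 2) < sres x - sres y ∧ sres x - sres y < 1 / 2 := by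
    by_cases hx : 1 / 2 ≤ Int.fract x
    · have h₁ := sres_neg_of_half_le_fract hx
      have h₂ := sres_neg_of_half_le_fract (h.1 hx)
      constructor <;> linarith [h₁.1, h₁.2, h₂.1, h₂.2]
    · have h₁ := sres_nonneg_of_fract_lt_half (not_le.1 hx)
      have h₂ := sres_nonneg_of_fract_lt_half (not_le.1 fun hy => hx (h.2 hy))
      constructor <;> linarith [h₁.1, h₁.2, h₂.1, h₂.2]
  have hround : round (x - y) = round x - round y := by
    rw [round_eq, Int.floor_eq_iff]
    simp only [sres] at hlt
    push_cast
    constructor <;> linarith [hlt.1, hlt.2]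
  simp only [sres, hround]
  push_cast
  ring

/-- The squared length of `q` with respect to `(α, β)`. -/
noncomputable def sqLen (α β : ℝ) (q : ℕ) : ℝ :=
  sres (q * α) ^ 2 + sres (q * β) ^ 2

lemma len2_eq_sqrt_sqLen (α β : ℝ) (q : ℕ) : len2 α β q = √(sqLen α β q) := by
  simp only [len2, nint, sq_abs, sqLen, sres]

lemma len2_le_len2_iff {α β : ℝ} {p q : ℕ} :
    len2 α β p ≤ len2 α β q ↔ sqLen α β p ≤ sqLen α β q := by
  rw [len2_eq_sqrt_sqLen, len2_eq_sqrt_sqLen]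
  exact Real.sqrt_le_sqrt_iff (by unfold sqLen; positivity)

lemma len2_lt_len2_iff {α β : ℝ} {p q : ℕ} :
    len2 α β p < len2 α β q ↔ sqLen α β p < sqLen α β q := by
  rw [← not_le, ← not_le, len2_le_len2_iff]

lemma typ2_eq_iff {α β : ℝ} {p q : ℕ} : typ2 α β p = typ2 α β q ↔
    (1 / 2 ≤ Int.fract ((p : ℝ) * α) ↔ 1 / 2 ≤ Int.fract ((q : ℝ) * α)) ∧
      (1 / 2 ≤ Int.fract ((p : ℝ) * β) ↔ 1 / 2 ≤ Int.fract ((q : ℝ) * β)) := by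
  simp only [typ2, Prod.mk.injEq]
  split_ifs <;> tauto

lemma sres_mul_nonneg_of_typ2_eq {α β : ℝ} {p q : ℕ} (h : typ2 α β p = typ2 α β q) :
    0 ≤ sres (p * α) * sres (q * α) ∧ 0 ≤ sres (p * β) * sres (q * β) :=
  ⟨sres_mul_nonneg (typ2_eq_iff.1 h).1, sres_mul_nonneg (typ2_eq_iff.1 h).2⟩

lemma sres_sub_of_typ2_eq {α β : ℝ} {p q : ℕ} (hpq : p ≤ q)
    (h : typ2 α β q = typ2 α β p) :
    sres ((q - p : ℕ) * α) = sres (q * α) - sres (p * α) ∧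
      sres ((q - p : ℕ) * β) = sres (q * β) - sres (p * β) := by
  rw [Nat.cast_sub hpq, sub_mul, sub_mul]
  exact ⟨sres_sub (typ2_eq_iff.1 h).1, sres_sub (typ2_eq_iff.1 h).2⟩

/-- The squared length is superadditive on integers of the same type: if `p`, `q` and `q - p` all
have the same type, the squared lengths of `p` and `q - p` add up to at most that of `q`. -/
lemma sqLen_add_sqLen_sub_le {α β : ℝ} {p q : ℕ} (hpq : p ≤ q)
    (h : typ2 α β q = typ2 α β p) (hsub : typ2 α β (q - p) = typ2 α β p) :
    sqLen α β p + sqLen α β (q - p) ≤ sqLen α β q := by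
  obtain ⟨h₁, h₂⟩ := sres_sub_of_typ2_eq hpq h
  obtain ⟨h₃, h₄⟩ := sres_mul_nonneg_of_typ2_eq hsub
  simp only [sqLen]
  rw [h₁] at h₃ ⊢
  rw [h₂] at h₄ ⊢
  linarith

lemma sqLen_sub_le {α β : ℝ} {p q : ℕ} (hpq : p ≤ q) (h : typ2 α β q = typ2 α β p) :
    sqLen α β (q - p) ≤ sqLen α β p + sqLen α β q := by
  obtain ⟨h₁, h₂⟩ := sres_sub_of_typ2_eq hpq h
  obtain ⟨h₃, h₄⟩ := sres_mul_nonneg_of_typ2_eq h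
  simp only [sqLen, h₁, h₂]
  linarith

/-- Two plane vectors at an acute angle that are both shorter than their difference make an
angle of more than `π / 4`. -/
lemma dot_sq_lt_det_sq {a b c d : ℝ} (h : 0 ≤ a * c + b * d)
    (h₁ : a ^ 2 + b ^ 2 < (a - c) ^ 2 + (b - d) ^ 2)
    (h₂ : c ^ 2 + d ^ 2 < (a - c) ^ 2 + (b - d) ^ 2) :
    (a * c + b * d) ^ 2 < (a * d - b * c) ^ 2 := by
  have h₃ : 2 * (a * c + b * d) < a ^ 2 + b ^ 2 := by linarith
  have h₄ : 2 * (a * c + b * d) < c ^ 2 + d ^ 2 := by linarith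
  have h₅ : 2 * (a * c + b * d) * (2 * (a * c + b * d)) <
      (a ^ 2 + b ^ 2) * (c ^ 2 + d ^ 2) :=
    mul_lt_mul'' h₄ h₃ (by linarith) (by linarith) |>.trans_eq (mul_comm _ _)
  nlinarith [sq_nonneg (a * c + b * d)]

/-- Three plane vectors cannot make two consecutive angles in `(π / 4, π / 2]`, in the same
direction, with the outer two at an acute angle. -/
lemma det_mul_det_nonpos {a b c d e f : ℝ} (h₁ : 0 ≤ a * c + b * d)
    (h₂ : 0 ≤ c * e + d * f) (h₃ : 0 ≤ a * e + b * f)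
    (h₄ : (a * c + b * d) ^ 2 < (a * d - b * c) ^ 2)
    (h₅ : (c * e + d * f) ^ 2 < (c * f - d * e) ^ 2) :
    (a * d - b * c) * (c * f - d * e) ≤ 0 := by
  by_contra! hpos
  have habs : (a * c + b * d) * (c * e + d * f) < |a * d - b * c| * |c * f - d * e| :=
    mul_lt_mul'' (by simpa only [abs_of_nonneg h₁] using sq_lt_sq.1 h₄)
      (by simpa only [abs_of_nonneg h₂] using sq_lt_sq.1 h₅) h₁ h₂
  rw [← abs_mul, abs_of_pos hpos] at habs
  nlinarith [mul_nonneg h₃ (add_nonneg (sq_nonneg c) (sq_nonneg d))]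

/-- Three plane vectors pairwise at acute angles cannot all be pairwise further apart than
`π / 4`. -/
lemma not_three_dot_sq_lt_det_sq {a b c d e f : ℝ} (h₁ : 0 ≤ a * c + b * d)
    (h₂ : 0 ≤ c * e + d * f) (h₃ : 0 ≤ a * e + b * f)
    (h₄ : (a * c + b * d) ^ 2 < (a * d - b * c) ^ 2)
    (h₅ : (c * e + d * f) ^ 2 < (c * f - d * e) ^ 2)
    (h₆ : (a * e + b * f) ^ 2 < (a * f - b * e) ^ 2) : False := by
  have k₁ := det_mul_det_nonpos h₁ h₂ h₃ h₄ h₅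
  have k₂ := det_mul_det_nonpos (a := c) (b := d) (c := e) (d := f) (e := a) (f := b)
    h₂ (by linarith) (by linarith) h₅ (by linarith)
  have k₃ := det_mul_det_nonpos (a := e) (b := f) (c := a) (d := b) (e := c) (f := d)
    (by linarith) h₁ (by linarith) (by linarith) h₄
  have n₁ : a * d - b * c ≠ 0 := fun h => by nlinarith [sq_nonneg (a * c + b * d)]
  have n₂ : c * f - d * e ≠ 0 := fun h => by nlinarith [sq_nonneg (c * e + d * f)]
  have n₃ : e * b - f * a ≠ 0 := fun h => by nlinarith [sq_nonneg (a * e + b * f)]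
  rcases n₁.lt_or_gt with s₁ | s₁ <;> rcases n₂.lt_or_gt with s₂ | s₂ <;>
    rcases n₃.lt_or_gt with s₃ | s₃ <;> nlinarith

/-- Two integers of the same type, both shorter than their difference, have residue vectors
at an angle of more than `π / 4`. -/
lemma sres_dot_sq_lt_det_sq {α β : ℝ} {p q : ℕ} (hpq : p ≤ q)
    (h : typ2 α β q = typ2 α β p) (hp : sqLen α β p < sqLen α β (q - p))
    (hq : sqLen α β q < sqLen α β (q - p)) :
    (sres (q * α) * sres (p * α) + sres (q * β) * sres (p * β)) ^ 2 <
      (sres (q * α) * sres (p * β) - sres (q * β) * sres (p * α)) ^ 2 := by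
  obtain ⟨h₁, h₂⟩ := sres_sub_of_typ2_eq hpq h
  obtain ⟨h₃, h₄⟩ := sres_mul_nonneg_of_typ2_eq h
  simp only [sqLen, h₁, h₂] at hp hq
  exact dot_sq_lt_det_sq (add_nonneg h₃ h₄) hq hp

/-- Lemma 2 of the paper: with `Q₁` the least minimiser of `ℓ` on `{1, …, ⌊n/2⌋}` and `Q₂`
the least minimiser of `ℓ` on `Q₁^⊥ = {1 ≤ q ≤ n − Q₁ : q` not of the same type as `Q₁}`,
there is at most one integer `q` with `1 ≤ q < Q₁` and `ℓ(q) < ℓ(Q₂)`. -/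
theorem at_most_one_short_below_Q₁ (α β : ℝ) (n : ℕ) (hn : 2 ≤ n) (Q₁ Q₂ : ℕ)
    (hQ₁ : IsLeast {q : ℕ | (1 ≤ q ∧ 2 * q ≤ n) ∧
      ∀ q' : ℕ, 1 ≤ q' → 2 * q' ≤ n → len2 α β q ≤ len2 α β q'} Q₁)
    (hperp : {q : ℕ | 1 ≤ q ∧ q ≤ n - Q₁ ∧ typ2 α β q ≠ typ2 α β Q₁}.Nonempty)
    (hQ₂ : IsLeast {q : ℕ | (1 ≤ q ∧ q ≤ n - Q₁ ∧ typ2 α β q ≠ typ2 α β Q₁) ∧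
      ∀ q' : ℕ, 1 ≤ q' → q' ≤ n - Q₁ → typ2 α β q' ≠ typ2 α β Q₁ →
        len2 α β q ≤ len2 α β q'} Q₂) :
    Set.ncard {q : ℕ | 1 ≤ q ∧ q < Q₁ ∧ len2 α β q < len2 α β Q₂} ≤ 1 := by
  obtain ⟨⟨⟨-, hQ₁n⟩, hQ₁min⟩, hQ₁least⟩ := hQ₁
  obtain ⟨⟨-, hQ₂min⟩, -⟩ := hQ₂
  have longer : ∀ q, 1 ≤ q → q < Q₁ → sqLen α β Q₁ < sqLen α β q := by
    intro q hq hlt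
    by_contra! hle
    refine hlt.not_ge (hQ₁least ⟨⟨hq, by omega⟩, fun q' h₁ h₂ => ?_⟩)
    exact (len2_le_len2_iff.2 hle).trans (hQ₁min q' h₁ h₂)
  have perp : ∀ q, 1 ≤ q → q < Q₁ → typ2 α β q ≠ typ2 α β Q₁ →
      sqLen α β Q₂ ≤ sqLen α β q := fun q hq hlt hne =>
    len2_le_len2_iff.1 (hQ₂min q hq (by omega) hne)
  have sameType : ∀ q, 1 ≤ q → q < Q₁ → sqLen α β q < sqLen α β Q₂ →
      typ2 α β q = typ2 α β Q₁ := fun q hq hlt hshort => by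
    by_contra hne
    exact hshort.not_ge (perp q hq hlt hne)
  have farFrom : ∀ q, 1 ≤ q → q < Q₁ → sqLen α β q < sqLen α β Q₂ →
      sqLen α β Q₂ ≤ sqLen α β (Q₁ - q) := fun q hq hlt hshort => by
    refine perp _ (by omega) (by omega) fun h => ?_
    have ht := sameType q hq hlt hshort
    have := sqLen_add_sqLen_sub_le hlt.le ht.symm (h.trans ht.symm)
    linarith [longer q hq hlt, longer (Q₁ - q) (by omega) (by omega),
      (by unfold sqLen; positivity : 0 ≤ sqLen α β (Q₁ - q))]
  have not_lt : ∀ p q, 1 ≤ p → p < q → q < Q₁ → sqLen α β p < sqLen α β Q₂ →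
      sqLen α β q < sqLen α β Q₂ → False := by
    intro p q hp hpq hq hps hqs
    have tp := sameType p hp (by omega) hps
    have tq := sameType q (by omega) hq hqs
    have fp := farFrom p hp (by omega) hps
    have fq := farFrom q (by omega) hq hqs
    have lp := longer p hp (by omega)
    have lq := longer q (by omega) hq
    by_cases hsub : typ2 α β (q - p) = typ2 α β Q₁
    · have h₁ := sqLen_add_sqLen_sub_le hpq.le (tq.trans tp.symm) (hsub.trans tp.symm)
      have h₂ := sqLen_sub_le (hpq.trans hq).le tp.symm
      linarith [longer (q - p) (by omega) (by omega)]
    · have fpq := perp (q - p) (by omega) (by omega) hsub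
      have h₁ := sres_mul_nonneg_of_typ2_eq tq.symm
      have h₂ := sres_mul_nonneg_of_typ2_eq (tq.trans tp.symm)
      have h₃ := sres_mul_nonneg_of_typ2_eq tp.symm
      exact not_three_dot_sq_lt_det_sq (add_nonneg h₁.1 h₁.2) (add_nonneg h₂.1 h₂.2)
        (add_nonneg h₃.1 h₃.2)
        (sres_dot_sq_lt_det_sq hq.le tq.symm (by linarith) (by linarith))
        (sres_dot_sq_lt_det_sq hpq.le (tq.trans tp.symm) (by linarith) (by linarith))
        (sres_dot_sq_lt_det_sq (hpq.trans hq).le tp.symm (by linarith) (by linarith))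
  have hfin : {q : ℕ | 1 ≤ q ∧ q < Q₁ ∧ len2 α β q < len2 α β Q₂}.Finite :=
    (Set.finite_lt_nat Q₁).subset fun q hq => hq.2.1
  rw [Set.ncard_le_one hfin]
  rintro p ⟨hp, hpQ, hps⟩ q ⟨hq, hqQ, hqs⟩
  rw [len2_lt_len2_iff] at hps hqs
  rcases lt_trichotomy p q with h | h | h
  · exact (not_lt p q hp h hqQ hps hqs).elim
  · exact h
  · exact (not_lt q p hq h hpQ hqs hps).elim
end

section
/- Let α and β be real numbers and n ≥ 2 an integer, and for a positive integer q define ℓ(q) = √(‖qα‖² + ‖qβ‖²). Say an integer q has type (s₁, s₂) ∈ {+,−}² where s₁ is + if {qα} ≥ 1/2 and − otherwise, and s₂ is + if {qβ} ≥ 1/2 and − otherwise; two types are opposite if they differ in both coordinates. Let Q₁ be the least integer in {1, …, ⌊n/2⌋} with ℓ(Q₁) ≤ ℓ(q) for all integers 1 ≤ q ≤ n/2. Let Q₁^⊥ = { q : 1 ≤ q ≤ n − Q₁, q does not have the same type as Q₁ }, assume Q₁^⊥ is nonempty, and let Q₂ be the least integer in Q₁^⊥ with ℓ(Q₂) ≤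 ℓ(q) for all q ∈ Q₁^⊥. Then the set { ℓ(q) : q an integer, n − Q₁ < q ≤ n, the type of q is opposite to the type of Q₁, and ℓ(q) < ℓ(Q₂) } has at most 4 elements. -/
open scoped Classical

/-- The representative of `x` modulo `1` lying in `[-1/2, 1/2)`. -/
noncomputable def centeredRes (x : ℝ) : ℝ := x - round x

/-- `true` when `x` is at least `1/2` modulo `1`, and `false` otherwise. -/
noncomputable def upperHalf (x : ℝ) : Bool := if 1 / 2 ≤ Int.fract x then true else false

/-- The centered residue, reflected so that arguments with `upperHalf x = t` are mapped to
nonpositive numbers. -/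
noncomputable def orientedRes (t : Bool) (x : ℝ) : ℝ := (if t then 1 else -1) * centeredRes x

lemma neg_half_le_centeredRes (x : ℝ) : -(1 / 2) ≤ centeredRes x := by
  have := Int.floor_le (x + 1 / 2)
  rw [centeredRes, round_eq]
  linarith

lemma centeredRes_lt_half (x : ℝ) : centeredRes x < 1 / 2 := by
  have := Int.lt_floor_add_one (x + 1 / 2)
  rw [centeredRes, round_eq]
  linarith

lemma upperHalf_eq_true_iff (x : ℝ) : upperHalf x = true ↔ centeredRes x < 0 := by
  have h0 := Int.fract_nonneg x
  have h1 := Int.fract_lt_one x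
  have hx := Int.floor_add_fract x
  by_cases h : 1 / 2 ≤ Int.fract x
  · have hr : round x = ⌊x⌋ + 1 := by
      rw [round_eq, Int.floor_eq_iff]
      push_cast
      constructor <;> linarith
    simp only [upperHalf, h, if_true, centeredRes, hr, true_iff]
    push_cast
    linarith
  · have hr : round x = ⌊x⌋ := by
      rw [round_eq, Int.floor_eq_iff]
      constructor <;> linarith
    simp only [upperHalf, h, if_false, centeredRes, hr, Bool.false_eq_true, false_iff]
    linarith

lemma centeredRes_sub {x y : ℝ} (h : upperHalf x = upperHalf y) :
    centeredRes (x - y) = centeredRes x - centeredRes y := by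
  have hxy : centeredRes x < 0 ↔ centeredRes y < 0 := by
    rw [← upperHalf_eq_true_iff, ← upperHalf_eq_true_iff, h]
  have hx := neg_half_le_centeredRes x
  have hx' := centeredRes_lt_half x
  have hy := neg_half_le_centeredRes y
  have hy' := centeredRes_lt_half y
  have hr : round (x - y) = round x - round y := by
    rw [round_eq, Int.floor_eq_iff]
    push_cast
    by_cases hs : centeredRes x < 0
    · have hs' := hxy.1 hs
      unfold centeredRes at *
      constructor <;> linarith
    · have hs' := mt hxy.2 hs
      unfold centeredRes at *
      constructor <;> linarith
  unfold centeredRes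
  rw [hr]
  push_cast
  ring

lemma orientedRes_sub (t : Bool) {x y : ℝ} (h : upperHalf x = upperHalf y) :
    orientedRes t (x - y) = orientedRes t x - orientedRes t y := by
  rw [orientedRes, centeredRes_sub h, mul_sub, orientedRes, orientedRes]

lemma orientedRes_nonpos {t : Bool} {x : ℝ} (h : upperHalf x = t) : orientedRes t x ≤ 0 := by
  have hx := upperHalf_eq_true_iff x
  cases t <;> (simp_all [orientedRes]; try linarith)

lemma orientedRes_nonneg {t : Bool} {x : ℝ} (h : upperHalf x = !t) : 0 ≤ orientedRes t x := by
  have hx := upperHalf_eq_true_iff x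
  cases t <;> (simp_all [orientedRes]; try linarith)

lemma orientedRes_sq (t : Bool) (x : ℝ) : orientedRes t x ^ 2 = nint x ^ 2 := by
  cases t <;> simp [orientedRes, nint, centeredRes, sub_sq_comm]

lemma len2_eq_sqrt_orientedRes (α β : ℝ) (s t : Bool) (q : ℕ) :
    len2 α β q = √(orientedRes s (q * α) ^ 2 + orientedRes t (q * β) ^ 2) := by
  rw [len2, orientedRes_sq, orientedRes_sq]

lemma typ2_eq_iff_s7 (α β : ℝ) (q : ℕ) (s t : Bool) :
    typ2 α β q = (s, t) ↔ upperHalf (q * α) = s ∧ upperHalf (q * β) = t :=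
  Prod.ext_iff

/-- A finite set with a relation whose directed paths have length at most one, and whose
unrelated elements are far apart, has at most four elements if no three elements are pairwise
far apart. -/
lemma card_le_four_of_no_path_of_no_far_triple {ι : Type*} [LinearOrder ι] (S : Finset ι)
    (R Far : ι → ι → Prop)
    (hsymm : ∀ a b, Far a b → Far b a)
    (hor : ∀ a ∈ S, ∀ b ∈ S, a < b → R a b ∨ Far a b)
    (hpath : ∀ a ∈ S, ∀ b ∈ S, ∀ c ∈ S, a < b → b < c → R a b → R b c → False)
    (hfar : ∀ a ∈ S, ∀ b ∈ S, ∀ c ∈ S, Far a b → Far b c → Far a c → False) :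
    S.card ≤ 4 := by
  have key : ∀ T ⊆ S, (∀ a ∈ T, ∀ b ∈ T, a < b → ¬ R a b) → T.card ≤ 2 := by
    intro T hT hind
    by_contra! h
    obtain ⟨a, b, c, ha, hb, hc, hab, hac, hbc⟩ := Finset.two_lt_card_iff.1 h
    have far : ∀ x ∈ T, ∀ y ∈ T, x ≠ y → Far x y := by
      intro x hx y hy hxy
      rcases lt_or_gt_of_ne hxy with hlt | hlt
      · exact (hor x (hT hx) y (hT hy) hlt).resolve_left (hind x hx y hy hlt)
      · exact hsymm _ _ ((hor y (hT hy) x (hT hx) hlt).resolve_left (hind y hy x hx hlt))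
    exact hfar a (hT ha) b (hT hb) c (hT hc) (far a ha b hb hab) (far b hb c hc hbc)
      (far a ha c hc hac)
  have hA := key (S.filter fun a => ∃ b ∈ S, a < b ∧ R a b) (Finset.filter_subset _ _) (by
    intro a ha b hb hab hR
    rw [Finset.mem_filter] at ha hb
    obtain ⟨c, hc, hbc, hR'⟩ := hb.2
    exact hpath a ha.1 b hb.1 c hc hab hbc hR hR')
  have hB := key (S.filter fun a => ¬ ∃ b ∈ S, a < b ∧ R a b) (Finset.filter_subset _ _) (by
    intro a ha b hb hab hR
    rw [Finset.mem_filter] at ha hb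
    exact ha.2 ⟨b, hb.1, hab, hR⟩)
  have := Finset.card_filter_add_card_filter_not (s := S) fun a => ∃ b ∈ S, a < b ∧ R a b
  omega

/-- An open quarter disc does not contain three points whose mutual distances are at least its
radius, stated for squared lengths and points ordered by first coordinate. -/
lemma no_sorted_far_triple {r x₁ y₁ x₂ y₂ x₃ y₃ : ℝ}
    (hx₁ : 0 ≤ x₁) (hy₁ : 0 ≤ y₁) (hy₂ : 0 ≤ y₂) (hy₃ : 0 ≤ y₃)
    (h₁ : x₁ ^ 2 + y₁ ^ 2 < r) (h₂ : x₂ ^ 2 + y₂ ^ 2 < r) (h₃ : x₃ ^ 2 + y₃ ^ 2 < r)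
    (h₁₂ : r ≤ (x₁ - x₂) ^ 2 + (y₁ - y₂) ^ 2) (h₂₃ : r ≤ (x₂ - x₃) ^ 2 + (y₂ - y₃) ^ 2)
    (hx₁₂ : x₁ ≤ x₂) (hx₂₃ : x₂ ≤ x₃) : False := by
  have hx₂ := hx₁.trans hx₁₂
  have hx₃ := hx₂.trans hx₂₃
  have descend : ∀ {x y x' y' : ℝ}, 0 ≤ x → 0 ≤ y → x ≤ x' → x' ^ 2 + y' ^ 2 < r →
      r ≤ (x - x') ^ 2 + (y - y') ^ 2 → y' ≤ y := by
    intro x y x' y' hx hy hxx h hd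
    by_contra! hlt
    nlinarith [mul_nonneg hx (sub_nonneg.2 hxx), mul_nonneg hy (sub_nonneg.2 hlt.le),
      mul_nonneg hx hx, mul_nonneg hy hy]
  have hy₁₂ := descend hx₁ hy₁ hx₁₂ h₂ h₁₂
  have hy₂₃ := descend hx₂ hy₂ hx₂₃ h₃ h₂₃
  nlinarith [mul_nonneg (sub_nonneg.2 hx₁₂) (sub_nonneg.2 hx₂₃),
    mul_nonneg (sub_nonneg.2 hy₁₂) (sub_nonneg.2 hy₂₃), mul_nonneg hx₁ hx₃, mul_nonneg hy₁ hy₃]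

/-- An open quarter disc does not contain three points whose mutual distances are at least its
radius, stated for squared lengths. -/
lemma no_far_triple {r x₁ y₁ x₂ y₂ x₃ y₃ : ℝ}
    (hx₁ : 0 ≤ x₁) (hy₁ : 0 ≤ y₁) (hx₂ : 0 ≤ x₂) (hy₂ : 0 ≤ y₂) (hx₃ : 0 ≤ x₃) (hy₃ : 0 ≤ y₃)
    (h₁ : x₁ ^ 2 + y₁ ^ 2 < r) (h₂ : x₂ ^ 2 + y₂ ^ 2 < r) (h₃ : x₃ ^ 2 + y₃ ^ 2 < r)
    (h₁₂ : r ≤ (x₁ - x₂) ^ 2 + (y₁ - y₂) ^ 2) (h₂₃ : r ≤ (x₂ - x₃) ^ 2 + (y₂ - y₃) ^ 2)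
    (h₁₃ : r ≤ (x₁ - x₃) ^ 2 + (y₁ - y₃) ^ 2) : False := by
  have h₂₁ : r ≤ (x₂ - x₁) ^ 2 + (y₂ - y₁) ^ 2 := by linarith
  have h₃₂ : r ≤ (x₃ - x₂) ^ 2 + (y₃ - y₂) ^ 2 := by linarith
  have h₃₁ : r ≤ (x₃ - x₁) ^ 2 + (y₃ - y₁) ^ 2 := by linarith
  rcases le_total x₁ x₂ with a | a <;> rcases le_total x₂ x₃ with b | b <;>
    rcases le_total x₁ x₃ with c | c
  · exact no_sorted_far_triple hx₁ hy₁ hy₂ hy₃ h₁ h₂ h₃ h₁₂ h₂₃ a b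
  · exact no_sorted_far_triple hx₁ hy₁ hy₂ hy₃ h₁ h₂ h₃ h₁₂ h₂₃ a b
  · exact no_sorted_far_triple hx₁ hy₁ hy₃ hy₂ h₁ h₃ h₂ h₁₃ h₃₂ c b
  · exact no_sorted_far_triple hx₃ hy₃ hy₁ hy₂ h₃ h₁ h₂ h₃₁ h₁₂ c a
  · exact no_sorted_far_triple hx₂ hy₂ hy₁ hy₃ h₂ h₁ h₃ h₂₁ h₁₃ a c
  · exact no_sorted_far_triple hx₂ hy₂ hy₃ hy₁ h₂ h₃ h₁ h₂₃ h₃₁ b c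
  · exact no_sorted_far_triple hx₃ hy₃ hy₂ hy₁ h₃ h₂ h₁ h₃₂ h₂₁ b a
  · exact no_sorted_far_triple hx₃ hy₃ hy₂ hy₁ h₃ h₂ h₁ h₃₂ h₂₁ b a

/-- Case 2 of the proof of the paper's Theorem 1: with `Q₁` the least minimiser of `ℓ` on
`{1, …, ⌊n/2⌋}` and `Q₂` the least minimiser of `ℓ` on
`Q₁^⊥ = {1 ≤ q ≤ n − Q₁ : q` not of the same type as `Q₁}`, the lengths of secondary
denominators (`n − Q₁ < q ≤ n` of type opposite to `Q₁` with `ℓ(q) < ℓ(Q₂)`) take at most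
four distinct values. -/
theorem secondary_lengths_at_most_four (α β : ℝ) (n : ℕ) (hn : 2 ≤ n) (Q₁ Q₂ : ℕ)
    (hQ₁ : IsLeast {q : ℕ | (1 ≤ q ∧ 2 * q ≤ n) ∧
      ∀ q' : ℕ, 1 ≤ q' → 2 * q' ≤ n → len2 α β q ≤ len2 α β q'} Q₁)
    (hperp : {q : ℕ | 1 ≤ q ∧ q ≤ n - Q₁ ∧ typ2 α β q ≠ typ2 α β Q₁}.Nonempty)
    (hQ₂ : IsLeast {q : ℕ | (1 ≤ q ∧ q ≤ n - Q₁ ∧ typ2 α β q ≠ typ2 α β Q₁) ∧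
      ∀ q' : ℕ, 1 ≤ q' → q' ≤ n - Q₁ → typ2 α β q' ≠ typ2 α β Q₁ →
        len2 α β q ≤ len2 α β q'} Q₂) :
    Set.ncard {x : ℝ | ∃ q : ℕ, n - Q₁ < q ∧ q ≤ n ∧
      (typ2 α β q).1 = !(typ2 α β Q₁).1 ∧ (typ2 α β q).2 = !(typ2 α β Q₁).2 ∧
      len2 α β q < len2 α β Q₂ ∧ x = len2 α β q} ≤ 4 := by
  obtain ⟨⟨⟨hQ₁pos, hQ₁n⟩, hQ₁min⟩, hQ₁least⟩ := hQ₁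
  have hQ₂min := hQ₂.1.2
  obtain ⟨s, t, hst⟩ : ∃ s t, typ2 α β Q₁ = (s, t) := ⟨_, _, rfl⟩
  simp only [hst] at hQ₂min ⊢
  set X : ℕ → ℝ := fun q => orientedRes s (q * α) with hX
  set Y : ℕ → ℝ := fun q => orientedRes t (q * β) with hY
  have hlen : ∀ q, len2 α β q = √(X q ^ 2 + Y q ^ 2) := len2_eq_sqrt_orientedRes α β s t
  have len_le : ∀ {a b}, len2 α β a ≤ len2 α β b → X a ^ 2 + Y a ^ 2 ≤ X b ^ 2 + Y b ^ 2 := by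
    intro a b h
    rw [hlen, hlen] at h
    exact (Real.sqrt_le_sqrt_iff (by positivity)).1 h
  have len_lt : ∀ {a b}, len2 α β a < len2 α β b → X a ^ 2 + Y a ^ 2 < X b ^ 2 + Y b ^ 2 := by
    intro a b h
    rw [hlen, hlen] at h
    exact (Real.sqrt_lt_sqrt_iff (by positivity)).1 h
  have short : ∀ d, 1 ≤ d → d < Q₁ → X Q₁ ^ 2 + Y Q₁ ^ 2 < X d ^ 2 + Y d ^ 2 := by
    intro d hd hdQ
    refine len_lt (lt_of_not_ge fun hle => ?_)
    exact absurd (hQ₁least ⟨⟨hd, by omega⟩, fun q' h1 h2 => hle.trans (hQ₁min q' h1 h2)⟩)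
      (not_le.2 hdQ)
  have typ_sub : ∀ {a b}, a ≤ b → typ2 α β b = typ2 α β a →
      X (b - a) = X b - X a ∧ Y (b - a) = Y b - Y a := by
    intro a b hab h
    have h' := (typ2_eq_iff_s7 α β b _ _).1 h
    constructor
    · simp only [hX, Nat.cast_sub hab, sub_mul]
      exact orientedRes_sub s h'.1
    · simp only [hY, Nat.cast_sub hab, sub_mul]
      exact orientedRes_sub t h'.2
  have nonpos : ∀ {a}, typ2 α β a = (s, t) → X a ≤ 0 ∧ Y a ≤ 0 := by
    intro a h
    have h' := (typ2_eq_iff_s7 α β a s t).1 h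
    exact ⟨orientedRes_nonpos h'.1, orientedRes_nonpos h'.2⟩
  have nonneg : ∀ {a}, typ2 α β a = (!s, !t) → 0 ≤ X a ∧ 0 ≤ Y a := by
    intro a h
    have h' := (typ2_eq_iff_s7 α β a _ _).1 h
    exact ⟨orientedRes_nonneg h'.1, orientedRes_nonneg h'.2⟩
  obtain ⟨hXQ, hYQ⟩ := nonpos hst
  set r := X Q₂ ^ 2 + Y Q₂ ^ 2 with hr
  let S : Finset ℕ := (Finset.Ioc (n - Q₁) n).filter fun q =>
    typ2 α β q = (!s, !t) ∧ len2 α β q < len2 α β Q₂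
  have mem_S : ∀ {q}, q ∈ S → (n - Q₁ < q ∧ q ≤ n) ∧ typ2 α β q = (!s, !t) ∧
      X q ^ 2 + Y q ^ 2 < r := by
    intro q hq
    rw [Finset.mem_filter, Finset.mem_Ioc] at hq
    exact ⟨hq.1, hq.2.1, len_lt hq.2.2⟩
  -- a difference of the same type as `Q₁` points away from `Q₁` and is long
  have step : ∀ a ∈ S, ∀ b ∈ S, a < b → typ2 α β (b - a) = (s, t) →
      X b ≤ X a ∧ Y b ≤ Y a ∧ r < 2 * ((X b - X a) ^ 2 + (Y b - Y a) ^ 2) := by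
    intro a ha b hb hab hR
    obtain ⟨⟨ha1, ha2⟩, hat, -⟩ := mem_S ha
    obtain ⟨⟨hb1, hb2⟩, hbt, -⟩ := mem_S hb
    obtain ⟨hx, hy⟩ := typ_sub hab.le (hbt.trans hat.symm)
    have hd : b - a < Q₁ := by omega
    have hs := short (b - a) (by omega) hd
    obtain ⟨hx', hy'⟩ := typ_sub hd.le (hst.trans hR.symm)
    obtain ⟨hdx, hdy⟩ := nonpos hR
    have hne : typ2 α β (Q₁ - (b - a)) ≠ (s, t) := by
      intro h
      obtain ⟨h1, h2⟩ := nonpos h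
      rw [hx'] at h1
      rw [hy'] at h2
      nlinarith
    have hlong := len_le (hQ₂min (Q₁ - (b - a)) (by omega) (by omega) hne)
    rw [hx', hy'] at hlong
    rw [← hx, ← hy]
    refine ⟨by linarith, by linarith, ?_⟩
    nlinarith [mul_nonneg_of_nonpos_of_nonpos hXQ hdx, mul_nonneg_of_nonpos_of_nonpos hYQ hdy]
  have hcard : S.card ≤ 4 := by
    refine card_le_four_of_no_path_of_no_far_triple S (fun a b => typ2 α β (b - a) = (s, t))
      (fun a b => r ≤ (X a - X b) ^ 2 + (Y a - Y b) ^ 2) ?_ ?_ ?_ ?_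
    · intro a b h
      linarith
    · intro a ha b hb hab
      refine or_iff_not_imp_left.2 fun hR => ?_
      obtain ⟨⟨ha1, ha2⟩, hat, -⟩ := mem_S ha
      obtain ⟨⟨hb1, hb2⟩, hbt, -⟩ := mem_S hb
      obtain ⟨hx, hy⟩ := typ_sub hab.le (hbt.trans hat.symm)
      have hlong := len_le (hQ₂min (b - a) (by omega) (by omega) hR)
      rw [hx, hy] at hlong
      linarith
    · intro a ha b hb c hc hab hbc hR hR'
      obtain ⟨h1, h2, h3⟩ := step a ha b hb hab hR
      obtain ⟨h1', h2', h3'⟩ := step b hb c hc hbc hR'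
      obtain ⟨-, -, har⟩ := mem_S ha
      obtain ⟨-, hct, -⟩ := mem_S hc
      obtain ⟨hcx, hcy⟩ := nonneg hct
      nlinarith [mul_nonneg (sub_nonneg.2 h1) (sub_nonneg.2 h1'),
        mul_nonneg (sub_nonneg.2 h2) (sub_nonneg.2 h2'),
        mul_nonneg hcx (sub_nonneg.2 (h1'.trans h1)), mul_nonneg hcy (sub_nonneg.2 (h2'.trans h2)),
        mul_nonneg hcx hcx, mul_nonneg hcy hcy]
    · intro a ha b hb c hc hab hbc hac
      obtain ⟨-, hat, har⟩ := mem_S ha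
      obtain ⟨-, hbt, hbr⟩ := mem_S hb
      obtain ⟨-, hct, hcr⟩ := mem_S hc
      exact no_far_triple (nonneg hat).1 (nonneg hat).2 (nonneg hbt).1 (nonneg hbt).2
        (nonneg hct).1 (nonneg hct).2 har hbr hcr hab hbc hac
  calc _ ≤ (S.image (len2 α β) : Set ℝ).ncard := by
        refine Set.ncard_le_ncard ?_ (Finset.finite_toSet _)
        rintro x ⟨q, h1, h2, h3, h4, h5, rfl⟩
        rw [Finset.mem_coe]
        exact Finset.mem_image_of_mem _
          (Finset.mem_filter.2 ⟨Finset.mem_Ioc.2 ⟨h1, h2⟩, Prod.ext h3 h4, h5⟩)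
    _ ≤ 4 := by
        rw [Set.ncard_coe_finset]
        exact Finset.card_image_le.trans hcard
end
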